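/- For subdiagrams B' ⊆ B of a diagram D, two chains C, C' from B' to B satisfy ι(C) = ι(C') if and only if C and C' are connected in the graph G_{B,B'}. Consequently, ι descends to a bijection from the set of equivalence classes of chains from B' to B under the equivalence relation generated by G_{B,B'} onto Ns(B,B'). -/

import Mathlib

/-- Two subdiagrams of a diagram `G` are *orthogonal* if they are disjoint and no edge of
`G` joins a vertex of one to a vertex of the other. -/
def Diagram.Orthogonal {V : Type*} (G : SimpleGraph V) (B₁ B₂ : Finset V) : Prop :=
  Disjoint B₁ B₂ ∧ ∀ i ∈ B₁, ∀ j ∈ B₂, ¬ G.Adj i j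

/-- Two subdiagrams are *compatible* if one contains the other or they are orthogonal. -/
def Diagram.Compatible {V : Type*} (G : SimpleGraph V) (B₁ B₂ : Finset V) : Prop :=
  B₁ ⊆ B₂ ∨ B₂ ⊆ B₁ ∨ Diagram.Orthogonal G B₁ B₂

/-- A subdiagram is *connected* if the induced subgraph is connected. -/
def Diagram.IsConnSub {V : Type*} (G : SimpleGraph V) (C : Finset V) : Prop :=
  (G.induce (C : Set V)).Connected

/-- `C` is a connected component of the subdiagram `B`. -/
def Diagram.IsCC {V : Type*} (G : SimpleGraph V) (B C : Finset V) : Prop :=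
  C ⊆ B ∧ Diagram.IsConnSub G C ∧
    ∀ C' : Finset V, C ⊆ C' → C' ⊆ B → Diagram.IsConnSub G C' → C' = C

/-- A *nested set on `B` relative to `B'`* (an element of `Ns(B,B')`): a collection of
pairwise compatible connected subdiagrams of `B` which contains every connected component
of `B` and of `B'`, and each of whose elements is compatible with, and not properly
contained in, any connected component of `B'`. -/
def Diagram.IsRelNested {V : Type*} (G : SimpleGraph V) (B B' : Finset V)
    (H : Finset (Finset V)) : Prop :=
  (∀ C ∈ H, C ⊆ B ∧ Diagram.IsConnSub G C) ∧
  (∀ C₁ ∈ H, ∀ C₂ ∈ H, Diagram.Compatible G C₁ C₂) ∧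
  (∀ C : Finset V, Diagram.IsCC G B C → C ∈ H) ∧
  (∀ C : Finset V, Diagram.IsCC G B' C → C ∈ H) ∧
  (∀ C ∈ H, ∀ C' : Finset V, Diagram.IsCC G B' C' → Diagram.Compatible G C C' ∧ ¬ C ⊂ C')

/-- A *maximal* nested set on `B` relative to `B'`: one maximal with respect to inclusion
among relative nested sets. -/
def Diagram.IsMaxRelNested {V : Type*} (G : SimpleGraph V) (B B' : Finset V)
    (H : Finset (Finset V)) : Prop :=
  Diagram.IsRelNested G B B' H ∧
    ∀ H' : Finset (Finset V), Diagram.IsRelNested G B B' H' → H ⊆ H' → H' = H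

/-- A *chain* from `B'` to `B`: a strictly increasing sequence of subdiagrams
`B' = B₀ ⊊ B₁ ⊊ ⋯ ⊊ B_m = B`, encoded as the list `[B₀, B₁, …, B_m]`. -/
def Diagram.IsChainList {V : Type*} (B' B : Finset V) (l : List (Finset V)) : Prop :=
  l.Chain' (· ⊂ ·) ∧ l.head? = some B' ∧ l.getLast? = some B

/-- A *maximal chain*: a chain whose consecutive terms differ by exactly one vertex. -/
def Diagram.IsMaxChainList {V : Type*} [DecidableEq V] (B' B : Finset V)
    (l : List (Finset V)) : Prop :=
  Diagram.IsChainList B' B l ∧ l.Chain' (fun X Y => (Y \ X).card = 1)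

open Classical in
/-- The finite set of connected components of the subdiagram `B`. -/
noncomputable def Diagram.ccFinset {V : Type*} [Fintype V] [DecidableEq V]
    (G : SimpleGraph V) (B : Finset V) : Finset (Finset V) :=
  Finset.univ.filter (fun C => Diagram.IsCC G B C)

/-- The map `ι` sending a chain to the collection of all connected components of all of
its terms. -/
noncomputable def Diagram.iotaChain {V : Type*} [Fintype V] [DecidableEq V]
    (G : SimpleGraph V) (l : List (Finset V)) : Finset (Finset V) :=
  l.foldr (fun Bk acc => Diagram.ccFinset G Bk ∪ acc) ∅

/-- The edge relation of the graph `G_{B,B'}` on chains: two chains are joined by an edge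
whenever one is obtained from the other by inserting, between two consecutive terms of the
form `B₁' ⊔ B₂' ⊊ B₁ ⊔ B₂` (with `B₁` orthogonal to `B₂`, `B₁' ⊆ B₁` and `B₂' ⊆ B₂`), an
intermediate term `B₁ ⊔ B₂'` or `B₁' ⊔ B₂`. -/
def Diagram.ChainEdge {V : Type*} [DecidableEq V] (G : SimpleGraph V)
    (c c' : List (Finset V)) : Prop :=
  ∃ (l₁ l₂ : List (Finset V)) (B₁ B₂ B₁' B₂' : Finset V),
    Diagram.Orthogonal G B₁ B₂ ∧ B₁' ⊆ B₁ ∧ B₂' ⊆ B₂ ∧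
    c = l₁ ++ [B₁' ∪ B₂', B₁ ∪ B₂] ++ l₂ ∧
    (c' = l₁ ++ [B₁' ∪ B₂', B₁ ∪ B₂', B₁ ∪ B₂] ++ l₂ ∨
      c' = l₁ ++ [B₁' ∪ B₂', B₁' ∪ B₂, B₁ ∪ B₂] ++ l₂)

namespace Diagram

section Components

variable {V : Type*} {G : SimpleGraph V} {B₁ B₂ C E X Y : Finset V}

lemma IsConnSub.nonempty (h : IsConnSub G C) : C.Nonempty := by
  obtain ⟨v⟩ := SimpleGraph.Connected.nonempty h
  exact ⟨v.1, v.2⟩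

lemma Orthogonal.symm (h : Orthogonal G B₁ B₂) : Orthogonal G B₂ B₁ :=
  ⟨h.1.symm, fun i hi j hj hij => h.2 j hj i hi hij.symm⟩

lemma Orthogonal.mono (h : Orthogonal G B₁ B₂) (h₁ : X ⊆ B₁) (h₂ : Y ⊆ B₂) :
    Orthogonal G X Y :=
  ⟨h.1.mono h₁ h₂, fun i hi j hj => h.2 i (h₁ hi) j (h₂ hj)⟩

lemma Compatible.symm (h : Compatible G B₁ B₂) : Compatible G B₂ B₁ := by
  rcases h with h | h | h
  exacts [.inr (.inl h), .inl h, .inr (.inr h.symm)]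

lemma Orthogonal.not_subset (h : Orthogonal G B₁ B₂) (h₁ : B₁.Nonempty) : ¬ B₁ ⊆ B₂ := by
  obtain ⟨v, hv⟩ := h₁
  exact fun hs => Finset.disjoint_left.1 h.1 hv (hs hv)

lemma IsConnSub.union [DecidableEq V] (h₁ : IsConnSub G B₁) (h₂ : IsConnSub G B₂)
    (h : ¬ Orthogonal G B₁ B₂) : IsConnSub G (B₁ ∪ B₂) := by
  unfold IsConnSub at *
  by_cases hd : Disjoint B₁ B₂
  · simp only [Orthogonal, hd, true_and] at h
    push Not at h
    obtain ⟨i, hi, j, hj, hij⟩ := h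
    have h₃ := G.induce_union_connected h₁.preconnected
      (G.induce_pair_connected_of_adj hij).preconnected ⟨i, hi, by simp⟩
    have h₄ := G.induce_union_connected h₃.preconnected h₂.preconnected
      ⟨j, .inr (by simp), hj⟩
    have hs : (B₁ ∪ {i, j} ∪ B₂ : Set V) = ((B₁ ∪ B₂ : Finset V) : Set V) := by
      ext v
      simp only [Finset.coe_union, Set.mem_union, Finset.mem_coe, Set.mem_insert_iff, Set.mem_singleton_iff]
      grind
    rw [hs] at h₄
    exact h₄
  · obtain ⟨v, hv₁, hv₂⟩ := Finset.not_disjoint_iff.1 hd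
    rw [Finset.coe_union]
    exact G.induce_union_connected h₁.preconnected h₂.preconnected ⟨v, hv₁, hv₂⟩

lemma IsConnSub.subset_or_subset [DecidableEq V] (hC : IsConnSub G C)
    (h : Orthogonal G B₁ B₂) (hs : C ⊆ B₁ ∪ B₂) : C ⊆ B₁ ∨ C ⊆ B₂ := by
  have key : ∀ {X Y : Finset V}, Orthogonal G X Y → C ⊆ X ∪ Y → ∀ v ∈ C, v ∈ X → C ⊆ X := by
    intro X Y hXY hCXY v hv hvX w hw
    have hr := (SimpleGraph.reachable_iff_reflTransGen _ _).1
      (hC.preconnected ⟨v, hv⟩ ⟨w, hw⟩)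
    have : ∀ z, Relation.ReflTransGen (G.induce (C : Set V)).Adj ⟨v, hv⟩ z → z.1 ∈ X := by
      intro z hz
      induction hz with
      | refl => exact hvX
      | @tail b c _ hbc ih =>
        rcases Finset.mem_union.1 (hCXY c.2) with hc | hc
        · exact hc
        · exact (hXY.2 _ ih _ hc hbc).elim
    exact this _ hr
  obtain ⟨v, hv⟩ := hC.nonempty
  rcases Finset.mem_union.1 (hs hv) with hv' | hv'
  · exact .inl (key h hs v hv hv')
  · exact .inr (key h.symm (Finset.union_comm B₁ B₂ ▸ hs) v hv hv')

lemma IsCC.anti (h : IsCC G X C) (hC : C ⊆ Y) (hY : Y ⊆ X) : IsCC G Y C :=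
  ⟨hC, h.2.1, fun C' h₁ h₂ h₃ => h.2.2 C' h₁ (h₂.trans hY) h₃⟩

lemma IsConnSub.isCC_self (h : IsConnSub G C) : IsCC G C C :=
  ⟨subset_rfl, h, fun _ h₁ h₂ _ => h₂.antisymm h₁⟩

lemma isCC_union_iff [DecidableEq V] (h : Orthogonal G B₁ B₂) :
    IsCC G (B₁ ∪ B₂) C ↔ IsCC G B₁ C ∨ IsCC G B₂ C := by
  constructor
  · intro hC
    rcases hC.2.1.subset_or_subset h hC.1 with hs | hs
    · exact .inl (hC.anti hs Finset.subset_union_left)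
    · exact .inr (hC.anti hs Finset.subset_union_right)
  · rintro (hC | hC)
    · refine ⟨hC.1.trans Finset.subset_union_left, hC.2.1, fun C' h₁ h₂ h₃ => ?_⟩
      rcases h₃.subset_or_subset h h₂ with hs | hs
      · exact hC.2.2 _ h₁ hs h₃
      · exact ((h.mono hC.1 subset_rfl).not_subset hC.2.1.nonempty (h₁.trans hs)).elim
    · refine ⟨hC.1.trans Finset.subset_union_right, hC.2.1, fun C' h₁ h₂ h₃ => ?_⟩
      rcases h₃.subset_or_subset h h₂ with hs | hs
      · exact ((h.symm.mono hC.1 subset_rfl).not_subset hC.2.1.nonempty (h₁.trans hs)).elim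
      · exact hC.2.2 _ h₁ hs h₃

lemma IsCC.subset_or_orthogonal [DecidableEq V] (hE : IsCC G X E) (hC : IsConnSub G C)
    (hs : C ⊆ X) : C ⊆ E ∨ Orthogonal G C E := by
  by_contra! h
  have := hE.2.2 (C ∪ E) Finset.subset_union_right (Finset.union_subset hs hE.1)
    (hC.union hE.2.1 h.2)
  exact h.1 (this ▸ Finset.subset_union_left)

lemma IsCC.compatible [DecidableEq V] (hC : IsCC G X C) (hE : IsCC G Y E) (h : X ⊆ Y) :
    Compatible G C E :=
  (hE.subset_or_orthogonal hC.2.1 (hC.1.trans h)).imp_right .inr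

lemma IsConnSub.exists_isCC [Finite V] (hC : IsConnSub G C) (hs : C ⊆ X) :
    ∃ E, IsCC G X E ∧ C ⊆ E := by
  obtain ⟨E, ⟨h₁, h₂, h₃⟩, hE⟩ := exists_maximal_of_wellFoundedGT
    (fun E => C ⊆ E ∧ E ⊆ X ∧ IsConnSub G E) ⟨C, subset_rfl, hs, hC⟩
  exact ⟨E, ⟨h₂, h₃, fun C' h h' hc =>
    (hE ⟨h₁.trans h, h', hc⟩ h).antisymm h⟩, h₁⟩

lemma exists_isCC_mem [Finite V] {v : V} (hv : v ∈ X) : ∃ E, IsCC G X E ∧ v ∈ E := by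
  have : IsConnSub G {v} := by
    unfold IsConnSub
    rw [Finset.coe_singleton]
    exact SimpleGraph.Connected.mk SimpleGraph.Preconnected.of_subsingleton
  obtain ⟨E, hE, h⟩ := this.exists_isCC (Finset.singleton_subset_iff.2 hv)
  exact ⟨E, hE, Finset.singleton_subset_iff.1 h⟩

lemma orthogonal_sdiff [Finite V] [DecidableEq V]
    (h : ∀ E, IsCC G X E → E ⊆ C ∨ Orthogonal G C E) : Orthogonal G C (X \ C) := by
  refine ⟨Finset.disjoint_sdiff, fun i hi j hj => ?_⟩
  obtain ⟨hjX, hjC⟩ := Finset.mem_sdiff.1 hj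
  obtain ⟨E, hE, hjE⟩ := exists_isCC_mem (G := G) hjX
  rcases h E hE with hs | ho
  · exact (hjC (hs hjE)).elim
  · exact ho.2 i hi j hjE

lemma isCC_union_sdiff_iff [DecidableEq V] (hC : IsConnSub G C)
    (ho : Orthogonal G C (X \ C)) :
    IsCC G (X ∪ C) E ↔ E = C ∨ IsCC G X E ∧ ¬ E ⊆ C := by
  have hXC : X ∪ C = C ∪ X \ C := by simp [Finset.union_comm]
  have hX : X = X ∩ C ∪ X \ C := by
    ext v; simp only [Finset.mem_union, Finset.mem_inter, Finset.mem_sdiff]; tauto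
  have hc : IsCC G C E ↔ E = C :=
    ⟨fun h => (h.2.2 C h.1 subset_rfl hC).symm, fun h => h ▸ hC.isCC_self⟩
  rw [hXC, isCC_union_iff ho, hc]
  refine or_congr_right ⟨fun h => ⟨?_, (ho.symm.mono h.1 subset_rfl).not_subset h.2.1.nonempty⟩,
    fun ⟨h, hn⟩ => ?_⟩
  · rw [hX]
    exact (isCC_union_iff (ho.mono Finset.inter_subset_right subset_rfl)).2 (.inr h)
  · rw [hX] at h
    rcases (isCC_union_iff (ho.mono Finset.inter_subset_right subset_rfl)).1 h with h | h
    · exact (hn (h.1.trans Finset.inter_subset_right)).elim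
    · exact h

end Components

section Chains

variable {V : Type*} {B B' C D X Y : Finset V} {l l' : List (Finset V)}

lemma isChainList_iff : IsChainList B' B l ↔
    l = [B'] ∧ B' = B ∨ ∃ X t, B' ⊂ X ∧ IsChainList X B t ∧ l = B' :: t := by
  rcases l with _ | ⟨Y, _ | ⟨Z, t⟩⟩
  · simp [IsChainList]
  · simp only [IsChainList, List.Chain', List.isChain_singleton, List.head?_cons,
      List.getLast?_singleton, Option.some.injEq, true_and, List.cons.injEq, and_true]
    constructor
    · rintro ⟨rfl, rfl⟩
      simp
    · rintro (⟨rfl, rfl⟩ | ⟨X, t, _, ⟨_, h, _⟩, _, rfl⟩)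
      · simp
      · simp at h
  · simp only [IsChainList, List.Chain', List.isChain_cons_cons, List.head?_cons,
      List.getLast?_cons_cons, Option.some.injEq, List.cons.injEq, reduceCtorEq, and_false,
      false_and, false_or]
    constructor
    · rintro ⟨⟨h, h'⟩, rfl, h₃⟩
      exact ⟨Z, Z :: t, h, ⟨h', rfl, h₃⟩, rfl, rfl⟩
    · rintro ⟨X, _, h, ⟨h₁, h₂, h₃⟩, rfl, rfl⟩
      obtain rfl : Z = X := by simpa using h₂
      exact ⟨⟨h, h₁⟩, rfl, h₃⟩

lemma IsChainList.cons (h : IsChainList X B l) (hX : B' ⊂ X) : IsChainList B' B (B' :: l) :=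
  isChainList_iff.2 (.inr ⟨X, l, hX, h, rfl⟩)

lemma isChainList_singleton : IsChainList B B [B] :=
  isChainList_iff.2 (.inl ⟨rfl, rfl⟩)

lemma IsChainList.induction 
    {motive : ∀ (X : Finset V) (t : List (Finset V)), IsChainList X B t → Prop}
    (single : motive B [B] isChainList_singleton)
    (cons : ∀ B' X l (hX : B' ⊂ X) (hl : IsChainList X B l), motive X l hl →
      motive B' (B' :: l) (hl.cons hX))
    (h : IsChainList B' B l) : motive B' l h := by
  induction l generalizing B' with
  | nil => simp [IsChainList] at h
  | cons Y t ih =>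
    rcases isChainList_iff.1 h with ⟨hl, rfl⟩ | ⟨X, t', hX, ht, hl⟩
    · obtain ⟨rfl, rfl⟩ := List.cons.inj hl
      exact single
    · obtain ⟨rfl, rfl⟩ := List.cons.inj hl
      exact cons _ _ _ hX ht (ih ht)

lemma IsChainList.head_mem (h : IsChainList B' B l) : B' ∈ l :=
  List.mem_of_head? h.2.1

lemma IsChainList.last_mem (h : IsChainList B' B l) : B ∈ l :=
  List.mem_of_getLast? h.2.2

lemma IsChainList.bounds (h : IsChainList B' B l) : ∀ Y ∈ l, B' ⊆ Y ∧ Y ⊆ B := by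
  induction h using IsChainList.induction with
  | single => simp
  | cons B' X l hX hl ih =>
    intro Y hY
    rcases List.mem_cons.1 hY with rfl | hY
    · exact ⟨subset_rfl, hX.subset.trans (ih X hl.head_mem).2⟩
    · exact ⟨hX.subset.trans (ih Y hY).1, (ih Y hY).2⟩

lemma IsChainList.total (h : IsChainList B' B l) :
    ∀ Y ∈ l, ∀ Z ∈ l, Y ⊆ Z ∨ Z ⊆ Y := by
  induction h using IsChainList.induction with
  | single => simp
  | cons B' X l hX hl ih =>
    intro Y hY Z hZ
    have hb := (hl.cons hX).bounds
    rcases List.mem_cons.1 hY with rfl | hY'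
    · exact .inl (hb Z hZ).1
    · rcases List.mem_cons.1 hZ with rfl | hZ'
      · exact .inr (hb Y hY).1
      · exact ih Y hY' Z hZ'

lemma IsChainList.eq_singleton (h : IsChainList B B l) : l = [B] := by
  rcases isChainList_iff.1 h with ⟨hl, -⟩ | ⟨X, t, hX, ht, -⟩
  · exact hl
  · exact (hX.not_subset (ht.bounds X ht.head_mem).2).elim

variable [DecidableEq V] {G : SimpleGraph V}

lemma ChainEdge.cons (h : ChainEdge G l l') : ChainEdge G (Y :: l) (Y :: l') := by
  obtain ⟨l₁, l₂, B₁, B₂, B₁', B₂', ho, h₁, h₂, rfl, hl⟩ := h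
  refine ⟨Y :: l₁, l₂, B₁, B₂, B₁', B₂', ho, h₁, h₂, rfl, ?_⟩
  rcases hl with rfl | rfl
  exacts [.inl rfl, .inr rfl]

/-- The chains `l` and `l'` from `B'` to `B` are connected by a path of chain edges. -/
def ChainConnected (G : SimpleGraph V) (B' B : Finset V) (l l' : List (Finset V)) : Prop :=
  ∃ (h : IsChainList B' B l) (h' : IsChainList B' B l'),
    Relation.EqvGen (fun x y : {l : List (Finset V) // IsChainList B' B l} =>
      ChainEdge G x.1 y.1) ⟨l, h⟩ ⟨l', h'⟩

lemma ChainConnected.refl (h : IsChainList B' B l) : ChainConnected G B' B l l :=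
  ⟨h, h, .refl _⟩

lemma ChainConnected.symm (h : ChainConnected G B' B l l') : ChainConnected G B' B l' l :=
  ⟨h.2.1, h.1, .symm _ _ h.2.2⟩

lemma ChainConnected.trans {l'' : List (Finset V)} (h : ChainConnected G B' B l l')
    (h' : ChainConnected G B' B l' l'') : ChainConnected G B' B l l'' :=
  ⟨h.1, h'.2.1, .trans _ _ _ h.2.2 h'.2.2⟩

lemma ChainEdge.chainConnected (e : ChainEdge G l l') (h : IsChainList B' B l)
    (h' : IsChainList B' B l') : ChainConnected G B' B l l' :=
  ⟨h, h', .rel _ _ e⟩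

lemma ChainConnected.cons (h : ChainConnected G X B l l') (hX : B' ⊂ X) :
    ChainConnected G B' B (B' :: l) (B' :: l') := by
  obtain ⟨h, h', e⟩ := h
  have key : ∀ x y : {l : List (Finset V) // IsChainList X B l},
      Relation.EqvGen (fun x y => ChainEdge G x.1 y.1) x y →
      ChainConnected G B' B (B' :: x.1) (B' :: y.1) := by
    intro x y e
    induction e with
    | rel x y e => exact e.cons.chainConnected (x.2.cons hX) (y.2.cons hX)
    | refl x => exact .refl (x.2.cons hX)
    | symm x y _ ih => exact ih.symm
    | trans x y z _ _ ih ih' => exact ih.trans ih'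
  exact key _ _ e

lemma chainConnected_iff {c c' : {l : List (Finset V) // IsChainList B' B l}} :
    ChainConnected G B' B c.1 c'.1 ↔
      Relation.EqvGen (fun x y : {l : List (Finset V) // IsChainList B' B l} =>
        ChainEdge G x.1 y.1) c c' :=
  ⟨fun h => h.2.2, fun h => ⟨c.2, c'.2, h⟩⟩

/-- The two chains obtained by inserting `B' ∪ C` or `X` in `B' ⊂ X ∪ C` are connected to it. -/
lemma chainEdge_insert (ho : Orthogonal G C (X \ C)) (hX : B' ⊆ X) (t : List (Finset V)) :
    ChainEdge G (B' :: (X ∪ C) :: t) (B' :: (B' ∪ C) :: (X ∪ C) :: t) ∧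
    (X ∩ C ⊆ B' → ChainEdge G (B' :: (X ∪ C) :: t) (B' :: X :: (X ∪ C) :: t)) := by
  have h₁ : B' ∩ C ∪ B' \ C = B' := by grind
  have h₂ : C ∪ X \ C = X ∪ C := by grind
  have h₃ : C ∪ B' \ C = B' ∪ C := by grind
  refine ⟨⟨[], t, C, X \ C, B' ∩ C, B' \ C, ho, Finset.inter_subset_right,
    Finset.sdiff_subset_sdiff hX subset_rfl, ?_, .inl ?_⟩, fun hc =>
    ⟨[], t, C, X \ C, B' ∩ C, B' \ C, ho, Finset.inter_subset_right,
    Finset.sdiff_subset_sdiff hX subset_rfl, ?_, .inr ?_⟩⟩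
  · simp [h₁, h₂]
  · simp [h₁, h₂, h₃]
  · simp [h₁, h₂]
  · have h₄ : B' ∩ C ∪ X \ C = X := by grind
    simp [h₁, h₂, h₄]

variable [Fintype V]

lemma mem_iotaChain : C ∈ iotaChain G l ↔ ∃ X ∈ l, IsCC G X C := by
  induction l with
  | nil => simp [iotaChain]
  | cons Y t ih =>
    have : iotaChain G (Y :: t) = ccFinset G Y ∪ iotaChain G t := rfl
    rw [this, Finset.mem_union, ih]
    simp [ccFinset]

lemma ChainEdge.iotaChain_eq (h : ChainEdge G l l') : iotaChain G l = iotaChain G l' := by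
  obtain ⟨l₁, l₂, B₁, B₂, B₁', B₂', ho, h₁, h₂, rfl, hl⟩ := h
  have e := fun C => isCC_union_iff (C := C) ho
  have e' := fun C => isCC_union_iff (C := C) (ho.mono h₁ h₂)
  have e₁ := fun C => isCC_union_iff (C := C) (ho.mono subset_rfl h₂)
  have e₂ := fun C => isCC_union_iff (C := C) (ho.mono h₁ subset_rfl)
  ext C
  rcases hl with rfl | rfl <;>
  · simp only [mem_iotaChain, List.mem_append, List.mem_cons, List.not_mem_nil, or_false,
      or_and_right, exists_or, exists_eq_left, e, e', e₁, e₂]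
    grind

lemma ChainConnected.iotaChain_eq (h : ChainConnected G B' B l l') :
    iotaChain G l = iotaChain G l' := by
  obtain ⟨_, _, e⟩ := h
  have key : ∀ x y : {l : List (Finset V) // IsChainList B' B l},
      Relation.EqvGen (fun x y => ChainEdge G x.1 y.1) x y →
      iotaChain G x.1 = iotaChain G y.1 := by
    intro x y e
    induction e with
    | rel x y e => exact e.iotaChain_eq
    | refl x => rfl
    | symm x y _ ih => exact ih.symm
    | trans x y z _ _ ih ih' => exact ih.trans ih'
  exact key _ _ e

lemma IsChainList.compatible (h : IsChainList B' B l) (hC : C ∈ iotaChain G l)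
    (hD : D ∈ iotaChain G l) : Compatible G C D := by
  obtain ⟨Y, hY, hC⟩ := mem_iotaChain.1 hC
  obtain ⟨Z, hZ, hD⟩ := mem_iotaChain.1 hD
  rcases h.total Y hY Z hZ with hs | hs
  · exact hC.compatible hD hs
  · exact (hD.compatible hC hs).symm

lemma IsChainList.isRelNested (h : IsChainList B' B l) :
    IsRelNested G B B' (iotaChain G l) := by
  refine ⟨fun C hC => ?_, fun C hC D hD => h.compatible hC hD,
    fun C hC => mem_iotaChain.2 ⟨B, h.last_mem, hC⟩,
    fun C hC => mem_iotaChain.2 ⟨B', h.head_mem, hC⟩, fun C hC D hD =>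
    ⟨h.compatible hC (mem_iotaChain.2 ⟨B', h.head_mem, hD⟩), fun hCD => ?_⟩⟩
  · obtain ⟨Y, hY, hC⟩ := mem_iotaChain.1 hC
    exact ⟨hC.1.trans (h.bounds Y hY).2, hC.2.1⟩
  · obtain ⟨Y, hY, hC⟩ := mem_iotaChain.1 hC
    exact hCD.ne (hC.2.2 D hCD.subset (hD.1.trans (h.bounds Y hY).1) hD.2.1).symm

lemma IsChainList.isCC_head (h : IsChainList B' B l) (hC : C ∈ iotaChain G l)
    (hs : C ⊆ B') : IsCC G B' C := by
  obtain ⟨Y, hY, hC⟩ := mem_iotaChain.1 hC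
  exact hC.anti hs (h.bounds Y hY).1

/-- An element of `ι(l)` all of whose proper subelements lie in the first term `B'` can be
moved to the front: `l` is connected to a chain starting with `B' ⊂ B' ∪ C`. -/
lemma IsChainList.exists_chainConnected_union (h : IsChainList B' B l)
    (hC : C ∈ iotaChain G l) (hCB : ¬ C ⊆ B')
    (hmin : ∀ D ∈ iotaChain G l, D ⊂ C → D ⊆ B') :
    ∃ t, IsChainList (B' ∪ C) B t ∧ ChainConnected G B' B l (B' :: t) := by
  induction h using IsChainList.induction with
  | single =>
    obtain ⟨Y, hY, hC⟩ := mem_iotaChain.1 hC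
    exact (hCB (List.mem_singleton.1 hY ▸ hC.1)).elim
  | cons B' X l hX hl ih =>
    have hmono : ∀ {D}, D ∈ iotaChain G l → D ∈ iotaChain G (B' :: l) := fun hD => by
      obtain ⟨Y, hY, hD⟩ := mem_iotaChain.1 hD
      exact mem_iotaChain.2 ⟨Y, List.mem_cons_of_mem _ hY, hD⟩
    have hCl : C ∈ iotaChain G l := by
      obtain ⟨Y, hY, hCY⟩ := mem_iotaChain.1 hC
      rcases List.mem_cons.1 hY with rfl | hY
      · exact (hCB hCY.1).elim
      · exact mem_iotaChain.2 ⟨Y, hY, hCY⟩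
    have hB'C : B' ⊂ B' ∪ C := by grind
    have hcomp : ∀ E, IsCC G X E → Compatible G C E := fun E hE =>
      hl.compatible hCl (mem_iotaChain.2 ⟨X, hl.head_mem, hE⟩)
    have hCX : ∀ E, IsCC G X E → C ⊆ E → E = C := fun E hE hCE =>
      (hl.isCC_head hCl (hCE.trans hE.1)).2.2 E hCE hE.1 hE.2.1
    have ho : Orthogonal G C (X \ C) := orthogonal_sdiff fun E hE => by
      rcases hcomp E hE with hs | hs | ho
      · exact .inl (hCX E hE hs).subset
      · exact .inl hs
      · exact .inr ho
    by_cases hs : C ⊆ X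
    · rcases eq_or_ne X (B' ∪ C) with rfl | hne
      · exact ⟨l, hl, .refl (hl.cons hX)⟩
      · have hss : B' ∪ C ⊂ X := (Finset.union_subset hX.subset hs).ssubset_of_ne hne.symm
        refine ⟨(B' ∪ C) :: l, hl.cons hss, ?_⟩
        obtain ⟨t, rfl⟩ : ∃ t, l = X :: t := by
          rcases isChainList_iff.1 hl with ⟨rfl, -⟩ | ⟨_, t, _, _, rfl⟩
          exacts [⟨_, rfl⟩, ⟨_, rfl⟩]
        have := (chainEdge_insert ho hX.subset t).1
        rw [Finset.union_eq_left.2 hs] at this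
        exact this.chainConnected (hl.cons hX) ((hl.cons hss).cons hB'C)
    · obtain ⟨t, ht, hc⟩ := ih hCl hs fun D hD hDC => (hmin D (hmono hD) hDC).trans hX.subset
      have hXC : X ∩ C ⊆ B' := fun v hv => by
        obtain ⟨hvX, hvC⟩ := Finset.mem_inter.1 hv
        obtain ⟨E, hE, hvE⟩ := exists_isCC_mem (G := G) hvX
        rcases hcomp E hE with hCE | hEC | hCE
        · exact (hs (hCE.trans hE.1)).elim
        · refine hmin E (hmono (mem_iotaChain.2 ⟨X, hl.head_mem, hE⟩)) (hEC.ssubset_of_ne ?_) hvE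
          rintro rfl
          exact hs hE.1
        · exact (Finset.disjoint_left.1 hCE.1 hvC hvE).elim
      obtain ⟨t, rfl⟩ : ∃ t', t = (X ∪ C) :: t' := by
        rcases isChainList_iff.1 ht with ⟨rfl, -⟩ | ⟨_, t, _, _, rfl⟩
        exacts [⟨_, rfl⟩, ⟨_, rfl⟩]
      have hss : B' ∪ C ⊂ X ∪ C := by
        refine (Finset.union_subset_union hX.subset subset_rfl).ssubset_of_ne fun he => ?_
        obtain ⟨v, hvX, hv⟩ := Finset.exists_of_ssubset hX
        grind
      have hXs : X ⊂ X ∪ C := by grind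
      have hcons := ht.cons (hX.trans hXs)
      refine ⟨(B' ∪ C) :: (X ∪ C) :: t, ht.cons hss, (hc.cons hX).trans ?_⟩
      obtain ⟨e₁, e₂⟩ := chainEdge_insert ho hX.subset t
      exact ((e₂ hXC).chainConnected hcons ((ht.cons hXs).cons hX)).symm.trans
        (e₁.chainConnected hcons ((ht.cons hss).cons hB'C))

end Chains

section Nested

variable {V : Type*} [Fintype V] {G : SimpleGraph V} {B B' C D : Finset V}
  {H : Finset (Finset V)} {t : List (Finset V)}

lemma IsRelNested.isCC (h : IsRelNested G B B' H) (hD : D ∈ H) (hs : D ⊆ B') :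
    IsCC G B' D := by
  obtain ⟨E, hE, hDE⟩ := (h.1 D hD).2.exists_isCC hs
  rcases hDE.eq_or_ssubset with rfl | hss
  · exact hE
  · exact ((h.2.2.2.2 D hD E hE).2 hss).elim

variable [DecidableEq V]

lemma IsRelNested.orthogonal_sdiff (h : IsRelNested G B B' H) (hC : C ∈ H)
    (hCB : ¬ C ⊆ B') : Orthogonal G C (B' \ C) :=
  Diagram.orthogonal_sdiff fun E hE => by
    rcases (h.2.2.2.2 C hC E hE).1 with hs | hs | ho
    · exact (hCB (hs.trans hE.1)).elim
    · exact .inl hs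
    · exact .inr ho

lemma IsRelNested.exists_minimal (h : IsRelNested G B B' H) (hB : ¬ B ⊆ B') :
    ∃ C ∈ H, ¬ C ⊆ B' ∧ ∀ D ∈ H, D ⊂ C → D ⊆ B' := by
  obtain ⟨v, hv, hv'⟩ := Finset.not_subset.1 hB
  obtain ⟨E, hE, hvE⟩ := exists_isCC_mem (G := G) hv
  obtain ⟨C, ⟨hC, hCB⟩, hmin⟩ := exists_minimal_of_wellFoundedLT
    (fun C => C ∈ H ∧ ¬ C ⊆ B') ⟨E, h.2.2.1 E hE, fun hs => hv' (hs hvE)⟩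
  refine ⟨C, hC, hCB, fun D hD hDC => ?_⟩
  by_contra hDB
  exact hDC.not_subset (hmin ⟨hD, hDB⟩ hDC.subset)

lemma IsRelNested.filter (h : IsRelNested G B B' H) (hC : C ∈ H) (hCB : ¬ C ⊆ B') :
    IsRelNested G B (B' ∪ C) {D ∈ H | ¬ D ⊂ C} := by
  have hCc := (h.1 C hC).2
  have hcc : ∀ E, IsCC G (B' ∪ C) E → E = C ∨ IsCC G B' E ∧ ¬ E ⊆ C := fun E =>
    (isCC_union_sdiff_iff hCc (h.orthogonal_sdiff hC hCB)).1
  have hmem : ∀ E, IsCC G (B' ∪ C) E → E ∈ H := fun E hE => by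
    rcases hcc E hE with rfl | hE
    exacts [hC, h.2.2.2.1 E hE.1]
  simp only [IsRelNested, Finset.mem_filter]
  refine ⟨fun D hD => h.1 D hD.1, fun D hD E hE => h.2.1 D hD.1 E hE.1, fun E hE =>
    ⟨h.2.2.1 E hE, fun hEC => hEC.ne (hE.2.2 C hEC.subset (h.1 C hC).1 hCc).symm⟩, fun E hE =>
    ⟨hmem E hE, fun hEC => ?_⟩, fun D hD E hE => ⟨h.2.1 D hD.1 E (hmem E hE), fun hDE => ?_⟩⟩
  · rcases hcc E hE with rfl | hE
    exacts [hEC.ne rfl, hE.2 hEC.subset]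
  · rcases hcc E hE with rfl | hE
    exacts [hD.2 hDE, (h.2.2.2.2 D hD.1 E hE.1).2 hDE]

lemma mem_iotaChain_cons {l : List (Finset V)} :
    C ∈ iotaChain G (D :: l) ↔ IsCC G D C ∨ C ∈ iotaChain G l := by
  simp [mem_iotaChain]

lemma IsChainList.iotaChain_tail (ht : IsChainList (B' ∪ C) B t)
    (hC : C ∈ iotaChain G (B' :: t)) (hCB : ¬ C ⊆ B') :
    iotaChain G t = {D ∈ iotaChain G (B' :: t) | ¬ D ⊂ C} := by
  have hB' : B' ⊂ B' ∪ C := by grind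
  have hN := (ht.cons hB').isRelNested (G := G)
  ext D
  simp only [Finset.mem_filter]
  refine ⟨fun hD => ⟨mem_iotaChain_cons.2 (.inr hD), fun hDC => ?_⟩, fun ⟨hD, hDC⟩ => ?_⟩
  · obtain ⟨Y, hY, hD⟩ := mem_iotaChain.1 hD
    exact hDC.ne (hD.2.2 C hDC.subset
      (Finset.subset_union_right.trans (ht.bounds Y hY).1) (hN.1 C hC).2).symm
  · rcases mem_iotaChain_cons.1 hD with hD | hD
    · refine mem_iotaChain.2 ⟨B' ∪ C, ht.head_mem, (isCC_union_sdiff_iff (hN.1 C hC).2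
        (hN.orthogonal_sdiff hC hCB)).2 (.inr ⟨hD, fun hs => hDC (hs.ssubset_of_ne ?_)⟩)⟩
      rintro rfl
      exact hCB hD.1
    · exact hD

theorem chainConnected_of_iotaChain_eq {l l' : List (Finset V)} (h : IsChainList B' B l)
    (h' : IsChainList B' B l') (he : iotaChain G l = iotaChain G l') :
    ChainConnected G B' B l l' := by
  induction B' using WellFoundedGT.induction generalizing l l' with
  | ind B' ih =>
    by_cases hB : B ⊆ B'
    · obtain rfl := (h.bounds B h.last_mem).1.antisymm hB
      rw [h.eq_singleton, h'.eq_singleton]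
      exact .refl isChainList_singleton
    obtain ⟨C, hC, hCB, hmin⟩ := (h.isRelNested (G := G)).exists_minimal hB
    have hB' : B' ⊂ B' ∪ C := by grind
    obtain ⟨t, ht, hc⟩ := h.exists_chainConnected_union hC hCB hmin
    obtain ⟨t', ht', hc'⟩ := h'.exists_chainConnected_union (he ▸ hC) hCB (he ▸ hmin)
    have e := hc.iotaChain_eq
    have e' := hc'.iotaChain_eq
    have htt : iotaChain G t = iotaChain G t' := by
      rw [ht.iotaChain_tail (e ▸ hC) hCB, ht'.iotaChain_tail (e' ▸ he ▸ hC) hCB, ← e, ← e', he]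
    exact hc.trans (((ih _ hB' ht ht' htt).cons hB').trans hc'.symm)

theorem IsRelNested.exists_iotaChain_eq (h : IsRelNested G B B' H) (hs : B' ⊆ B) :
    ∃ l, IsChainList B' B l ∧ iotaChain G l = H := by
  induction B' using WellFoundedGT.induction generalizing H with
  | ind B' ih =>
    by_cases hB : B ⊆ B'
    · obtain rfl := hs.antisymm hB
      refine ⟨[B'], isChainList_singleton, ?_⟩
      ext D
      simp only [mem_iotaChain, List.mem_singleton, exists_eq_left]
      exact ⟨h.2.2.1 D, fun hD => h.isCC hD (h.1 D hD).1⟩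
    obtain ⟨C, hC, hCB, hmin⟩ := h.exists_minimal hB
    have hB' : B' ⊂ B' ∪ C := by grind
    obtain ⟨t, ht, he⟩ := ih _ hB' (h.filter hC hCB) (Finset.union_subset hs (h.1 C hC).1)
    refine ⟨B' :: t, ht.cons hB', ?_⟩
    ext D
    rw [mem_iotaChain_cons, he, Finset.mem_filter]
    refine ⟨?_, fun hD => ?_⟩
    · rintro (hD | hD)
      exacts [h.2.2.2.1 D hD, hD.1]
    · by_cases hDC : D ⊂ C
      · exact .inl (h.isCC hD (hmin D hD hDC))
      · exact .inr ⟨hD, hDC⟩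

end Nested

end Diagram

/-- For subdiagrams `B' ⊆ B` of a diagram, two chains `C, C'` from `B'` to `B` satisfy
`ι(C) = ι(C')` if and only if `C` and `C'` are connected in the graph `G_{B,B'}` (i.e.
related by the equivalence relation generated by its edge relation).  Consequently, `ι`
descends to a bijection from the set of equivalence classes of chains from `B'` to `B`
under the equivalence relation generated by `G_{B,B'}` onto `Ns(B,B')`. -/
theorem iotaChain_eq_iff_connected {V : Type*} [Fintype V] [DecidableEq V]
    (G : SimpleGraph V) (B B' : Finset V) (hsub : B' ⊆ B) :
    (∀ c c' : {l : List (Finset V) // Diagram.IsChainList B' B l},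
        Diagram.iotaChain G c.1 = Diagram.iotaChain G c'.1 ↔
          Relation.EqvGen (fun x y : {l : List (Finset V) // Diagram.IsChainList B' B l} =>
            Diagram.ChainEdge G x.1 y.1) c c') ∧
    ∃ f : Quot (fun x y : {l : List (Finset V) // Diagram.IsChainList B' B l} =>
        Diagram.ChainEdge G x.1 y.1) → Finset (Finset V),
      (∀ c : {l : List (Finset V) // Diagram.IsChainList B' B l},
        f (Quot.mk _ c) = Diagram.iotaChain G c.1) ∧
      Set.BijOn f Set.univ {H | Diagram.IsRelNested G B B' H} := by
  have key : ∀ c c' : {l : List (Finset V) // Diagram.IsChainList B' B l},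
      Diagram.iotaChain G c.1 = Diagram.iotaChain G c'.1 ↔
        Relation.EqvGen (fun x y : {l : List (Finset V) // Diagram.IsChainList B' B l} =>
          Diagram.ChainEdge G x.1 y.1) c c' := fun c c' =>
    ⟨fun h => Diagram.chainConnected_iff.1
      (Diagram.chainConnected_of_iotaChain_eq c.2 c'.2 h),
      fun h => (Diagram.chainConnected_iff.2 h).iotaChain_eq⟩
  refine ⟨key, Quot.lift (fun c => Diagram.iotaChain G c.1) fun _ _ e => e.iotaChain_eq,
    fun _ => rfl, ?_, ?_, ?_⟩
  · rintro ⟨c⟩ -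
    exact c.2.isRelNested
  · rintro ⟨c⟩ - ⟨c'⟩ - h
    exact Quot.eqvGen_sound ((key c c').1 h)
  · intro H hH
    obtain ⟨l, hl, he⟩ := Diagram.IsRelNested.exists_iotaChain_eq hH hsub
    exact ⟨Quot.mk _ ⟨l, hl⟩, Set.mem_univ _, he⟩
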